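/- (Second step in the proof of Theorem 3.2) Let F̄ be the fractal triple described below, let E be an irreducible Dirichlet form on V⁰ and r ∈ (0,∞)^{20} with Λ_r(E) = E. Then r̄ := max{ min(r_{2h+1}, r_{2h+2}) : h = 0,…,9 } satisfies r̄ > 2. -/

import Mathlib

/-- A Dirichlet form on a finite set `V`, invariant with respect to an additive
constant: a functional of the form `E u = ∑_{{p,q} ⊆ V, p ≠ q} c_{p,q} (u p - u q)²`
with nonnegative coefficients (encoded via a symmetric nonnegative coefficient
matrix, summing over ordered pairs; the diagonal terms vanish). -/
def IsDirichletForm {V : Type*} [Fintype V] (E : (V → ℝ) → ℝ) : Prop :=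
  ∃ c : V → V → ℝ, (∀ p q, 0 ≤ c p q) ∧ (∀ p q, c p q = c q p) ∧
    ∀ u : V → ℝ, E u = ∑ p, ∑ q, c p q * (u p - u q) ^ 2

/-- An irreducible Dirichlet form: moreover `E u = 0` iff `u` is constant. -/
def IsIrreducibleDirichletForm {V : Type*} [Fintype V] (E : (V → ℝ) → ℝ) : Prop :=
  IsDirichletForm E ∧ ∀ u : V → ℝ, E u = 0 ↔ ∀ p q, u p = u q

/-- The fractal triple `F̄` of Section 3, with `N = k = 20`. Points and maps are
indexed by `ZMod 20` (indices read modulo 20). `V⁰` is encoded by the injective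
family `P : ZMod 20 → V1` of points of the finite set `V¹ = V1`, and the
one-to-one maps `ψ i : V⁰ → V¹` are encoded as injective maps `ZMod 20 → V1`
covering `V¹`, with `ψ j (P j) = P j` and `P j ∉ ψ i (V⁰)` for `i ≠ j`.
The cells `V_i = ψ i (V⁰)` satisfy `V_i ∩ V_{i'} = ∅` if `i' ∉ {i-1, i, i+1}`,
and `V_i ∩ V_{i+1} = {Q̄_i}` where `Q̄_i = ψ i (P (i+1)) = ψ (i+1) (P i)` for `i`
odd and `Q̄_i = ψ i (P (i+9)) = ψ (i+1) (P (i-8))` for `i` even. -/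
structure ExampleFractal (V1 : Type*) [Fintype V1] where
  P : ZMod 20 → V1
  P_inj : Function.Injective P
  ψ : ZMod 20 → ZMod 20 → V1
  ψ_inj : ∀ i, Function.Injective (ψ i)
  cover : ∀ y : V1, ∃ i j, ψ i j = y
  fixed : ∀ j, ψ j j = P j
  sep : ∀ i j, i ≠ j → P j ∉ Set.range (ψ i)
  disj : ∀ i i' : ZMod 20, i' ≠ i - 1 → i' ≠ i → i' ≠ i + 1 →
    Set.range (ψ i) ∩ Set.range (ψ i') = ∅
  inter_odd : ∀ i : ZMod 20, i.val % 2 = 1 →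
    ψ i (i + 1) = ψ (i + 1) i ∧
    Set.range (ψ i) ∩ Set.range (ψ (i + 1)) = {ψ i (i + 1)}
  inter_even : ∀ i : ZMod 20, i.val % 2 = 0 →
    ψ i (i + 9) = ψ (i + 1) (i - 8) ∧
    Set.range (ψ i) ∩ Set.range (ψ (i + 1)) = {ψ i (i + 9)}

variable {V1 : Type*} [Fintype V1]

/-- `S_{1,r}(E)(v) = ∑ i, r i * E (v ∘ ψ i)`. -/
noncomputable def S1r (F : ExampleFractal V1) (r : ZMod 20 → ℝ)
    (E : (ZMod 20 → ℝ) → ℝ) (v : V1 → ℝ) : ℝ :=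
  ∑ i, r i * E (fun j => v (F.ψ i j))

/-- The renormalization operator:
`Λ_r(E)(u) = inf { S_{1,r}(E)(v) : v : V1 → ℝ, v = u on V⁰ }`. -/
noncomputable def Lam (F : ExampleFractal V1) (r : ZMod 20 → ℝ)
    (E : (ZMod 20 → ℝ) → ℝ) (u : ZMod 20 → ℝ) : ℝ :=
  sInf {x : ℝ | ∃ v : V1 → ℝ, (∀ j, v (F.P j) = u j) ∧ S1r F r E v = x}

/-- The index `l` such that the cell `ψ i` meets the previous cell at `ψ i l`; it meets the next
cell at `ψ i (l + 10)`. -/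
def leftIndex (i : ZMod 20) : ZMod 20 :=
  if i.val % 2 = 1 then i + 11 else i - 1

theorem ExampleFractal.eq_of_mem_consecutive (F : ExampleFractal V1) {i j j' : ZMod 20}
    (h : F.ψ i j = F.ψ (i + 1) j') : j = leftIndex i + 10 ∧ j' = leftIndex (i + 1) := by
  have hmem : F.ψ i j ∈ Set.range (F.ψ i) ∩ Set.range (F.ψ (i + 1)) := ⟨⟨j, rfl⟩, ⟨j', h.symm⟩⟩
  rcases Nat.mod_two_eq_zero_or_one i.val with hi | hi
  · obtain ⟨h1, h2⟩ := F.inter_even i hi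
    have hR : i + 9 = leftIndex i + 10 := by clear * - hi; revert i; decide
    have hL : i - 8 = leftIndex (i + 1) := by clear * - hi; revert i; decide
    rw [h2, Set.mem_singleton_iff] at hmem
    exact ⟨(F.ψ_inj i hmem).trans hR, (F.ψ_inj _ (h.symm.trans (hmem.trans h1))).trans hL⟩
  · obtain ⟨h1, h2⟩ := F.inter_odd i hi
    have hR : i + 1 = leftIndex i + 10 := by clear * - hi; revert i; decide
    have hL : i = leftIndex (i + 1) := by clear * - hi; revert i; decide
    rw [h2, Set.mem_singleton_iff] at hmem
    exact ⟨(F.ψ_inj i hmem).trans hR, (F.ψ_inj _ (h.symm.trans (hmem.trans h1))).trans hL⟩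

/-- Functions on the cells that take the value `a i` at the left and `a (i + 1)` at the right
junction point of the `i`-th cell glue to a function on `V¹`. -/
theorem ExampleFractal.exists_glue (F : ExampleFractal V1) (a : ZMod 20 → ℝ)
    (g : ZMod 20 → ZMod 20 → ℝ) (hl : ∀ i, g i (leftIndex i) = a i)
    (hrt : ∀ i, g i (leftIndex i + 10) = a (i + 1)) :
    ∃ v : V1 → ℝ, ∀ i j, v (F.ψ i j) = g i j := by
  have next : ∀ i j j', F.ψ i j = F.ψ (i + 1) j' → g i j = g (i + 1) j' := by
    intro i j j' h
    obtain ⟨rfl, rfl⟩ := F.eq_of_mem_consecutive h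
    rw [hl, hrt]
  have compat : ∀ i j i' j', F.ψ i j = F.ψ i' j' → g i j = g i' j' := by
    intro i j i' j' h
    by_cases h0 : i' = i
    · subst h0
      rw [F.ψ_inj _ h]
    by_cases h1 : i' = i + 1
    · subst h1
      exact next _ _ _ h
    by_cases h2 : i' = i - 1
    · obtain rfl : i = i' + 1 := by rw [h2]; ring
      exact (next _ _ _ h.symm).symm
    · have hmem : F.ψ i j ∈ Set.range (F.ψ i) ∩ Set.range (F.ψ i') := ⟨⟨j, rfl⟩, ⟨j', h.symm⟩⟩
      rw [F.disj i i' h2 h0 h1] at hmem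
      exact hmem.elim
  choose c k hck using F.cover
  exact ⟨fun y => g (c y) (k y), fun i j => compat _ _ _ _ (hck _)⟩

section DirichletForm

variable {V : Type*} [Fintype V] {E : (V → ℝ) → ℝ}

theorem IsDirichletForm.nonneg (hE : IsDirichletForm E) (u : V → ℝ) : 0 ≤ E u := by
  obtain ⟨c, hc, -, hEc⟩ := hE
  rw [hEc]
  exact Finset.sum_nonneg fun p _ => Finset.sum_nonneg fun q _ => mul_nonneg (hc p q) (sq_nonneg _)

theorem IsDirichletForm.affine (hE : IsDirichletForm E) (a b : ℝ) (u : V → ℝ) :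
    E (fun p => a + b * u p) = b ^ 2 * E u := by
  obtain ⟨c, -, -, hEc⟩ := hE
  simp only [hEc, Finset.mul_sum]
  refine Finset.sum_congr rfl fun p _ => Finset.sum_congr rfl fun q _ => ?_
  ring

theorem IsDirichletForm.continuous (hE : IsDirichletForm E) : Continuous E := by
  obtain ⟨c, -, -, hEc⟩ := hE
  rw [show E = _ from funext hEc]
  fun_prop

theorem IsDirichletForm.clamp_le (hE : IsDirichletForm E) (u : V → ℝ) :
    E (fun p => max 0 (min 1 (u p))) ≤ E u := by
  obtain ⟨c, hc, -, hEc⟩ := hE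
  rw [hEc, hEc]
  refine Finset.sum_le_sum fun p _ => Finset.sum_le_sum fun q _ =>
    mul_le_mul_of_nonneg_left (sq_le_sq.2 ?_) (hc p q)
  have h1 := abs_max_sub_max_le_max 0 (min 1 (u p)) 0 (min 1 (u q))
  have h2 := abs_min_sub_min_le_max 1 (u p) 1 (u q)
  simp only [sub_self, abs_zero, abs_nonneg, max_eq_right] at h1 h2
  exact h1.trans h2

/-- The effective conductance between two points is attained by some potential. -/
theorem IsDirichletForm.exists_min (hE : IsDirichletForm E) {x y : V} (hxy : x ≠ y) :
    ∃ f : V → ℝ, f x = 0 ∧ f y = 1 ∧ ∀ u : V → ℝ, u x = 0 → u y = 1 → E f ≤ E u := by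
  classical
  let K : Set (V → ℝ) := Set.pi Set.univ (fun _ => Set.Icc 0 1) ∩ {u | u x = 0 ∧ u y = 1}
  have hK : IsCompact K := by
    refine (isCompact_univ_pi fun _ => isCompact_Icc).inter_right ?_
    exact (isClosed_eq (continuous_apply x) continuous_const).inter
      (isClosed_eq (continuous_apply y) continuous_const)
  have hclamp : ∀ u : V → ℝ, u x = 0 → u y = 1 → (fun p => max 0 (min 1 (u p))) ∈ K := by
    intro u hx hy
    refine ⟨fun p _ => ⟨le_max_left _ _, max_le zero_le_one (min_le_left _ _)⟩, ?_, ?_⟩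
    · simp [hx]
    · simp [hy]
  have hne : K.Nonempty :=
    ⟨_, hclamp (Pi.single y 1) (Pi.single_eq_of_ne hxy 1) (Pi.single_eq_same y 1)⟩
  obtain ⟨f, hf, hmin⟩ := hK.exists_isMinOn hne hE.continuous.continuousOn
  exact ⟨f, hf.2.1, hf.2.2, fun u hx hy => (hmin (hclamp u hx hy)).trans (hE.clamp_le u)⟩

end DirichletForm

theorem Lam_le_S1r (F : ExampleFractal V1) {E : (ZMod 20 → ℝ) → ℝ} (hE : IsDirichletForm E)
    {r : ZMod 20 → ℝ} (hr : ∀ i, 0 < r i) (v : V1 → ℝ) :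
    Lam F r E (fun j => v (F.P j)) ≤ S1r F r E v := by
  refine csInf_le ⟨0, ?_⟩ ⟨v, fun _ => rfl, rfl⟩
  rintro _ ⟨w, -, rfl⟩
  exact Finset.sum_nonneg fun i _ => mul_nonneg (hr i).le (hE.nonneg _)

/-- A unit drop split over one cell and four pairs of cells, each pair having a cell of weight at
most `2`, can be chosen with energy less than `1 / 2`. -/
theorem exists_unit_drop_energy_lt {z : ℝ} (hz : 0 < z) {x y : Fin 4 → ℝ}
    (hxy : ∀ m, min (x m) (y m) ≤ 2) :
    ∃ (e : ℝ) (p q : Fin 4 → ℝ), e + ∑ m, (p m + q m) = 1 ∧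
      z * e ^ 2 + ∑ m, (x m * p m ^ 2 + y m * q m ^ 2) < 1 / 2 := by
  have hpair : ∀ m, ∃ s : ℝ, x m * s ^ 2 + y m * (1 - s) ^ 2 ≤ 2 := by
    intro m
    rcases min_le_iff.1 (hxy m) with h | h
    · exact ⟨1, by simpa using h⟩
    · exact ⟨0, by simpa using h⟩
  choose s hs using hpair
  have hpos : 0 < 1 + 2 * z := by positivity
  set e : ℝ := 1 / (1 + 2 * z) with he
  refine ⟨e, fun m => (1 - e) / 4 * s m, fun m => (1 - e) / 4 * (1 - s m), ?_, ?_⟩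
  · simp only [← mul_add, add_sub_cancel, mul_one]
    simp
    ring
  · have hsum : ∑ m, (x m * ((1 - e) / 4 * s m) ^ 2 + y m * ((1 - e) / 4 * (1 - s m)) ^ 2)
        ≤ ∑ _m : Fin 4, ((1 - e) / 4) ^ 2 * 2 := by
      refine Finset.sum_le_sum fun m _ => ?_
      calc _ = ((1 - e) / 4) ^ 2 * (x m * s m ^ 2 + y m * (1 - s m) ^ 2) := by ring
        _ ≤ _ := mul_le_mul_of_nonneg_left (hs m) (sq_nonneg _)
    have hval : z * e ^ 2 + (1 - e) ^ 2 / 2 = 1 / 2 - e / 2 := by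
      rw [he]; field_simp; ring
    have hepos : 0 < e := by positivity
    simp only [Finset.sum_const, Finset.card_univ, Fintype.card_fin, nsmul_eq_mul] at hsum
    push_cast at hsum
    nlinarith

theorem exists_arc {x : ℕ → ℝ} (hx : ∀ n, 0 < x n)
    (h : (∀ m < 4, min (x (2 * m)) (x (2 * m + 1)) ≤ 2) ∨
      ∀ m < 4, min (x (2 * m + 1)) (x (2 * m + 2)) ≤ 2) :
    ∃ B : ℕ → ℝ, B 0 = 0 ∧ B 9 = 1 ∧
      ∑ n ∈ Finset.range 9, x n * (B (n + 1) - B n) ^ 2 < 1 / 2 := by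
  suffices ∃ d : ℕ → ℝ, ∑ n ∈ Finset.range 9, d n = 1 ∧
      ∑ n ∈ Finset.range 9, x n * d n ^ 2 < 1 / 2 by
    obtain ⟨d, h1, h2⟩ := this
    refine ⟨fun n => ∑ k ∈ Finset.range n, d k, by simp, h1, ?_⟩
    simpa [Finset.sum_range_succ_sub_sum] using h2
  rcases h with h | h
  · obtain ⟨e, p, q, h1, h2⟩ := exists_unit_drop_energy_lt (hx 8)
      (x := fun m : Fin 4 => x (2 * m)) (y := fun m : Fin 4 => x (2 * m + 1)) fun m => h m m.2
    let D : ℕ → ℝ := fun n => [p 0, q 0, p 1, q 1, p 2, q 2, p 3, q 3, e].getD n 0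
    refine ⟨D, ?_, ?_⟩
    · simp [D, Fin.sum_univ_four, Finset.sum_range_succ] at h1 ⊢
      linarith
    · simp [D, Fin.sum_univ_four, Finset.sum_range_succ] at h2 ⊢
      linarith
  · obtain ⟨e, p, q, h1, h2⟩ := exists_unit_drop_energy_lt (hx 0)
      (x := fun m : Fin 4 => x (2 * m + 1)) (y := fun m : Fin 4 => x (2 * m + 2)) fun m => h m m.2
    let D : ℕ → ℝ := fun n => [e, p 0, q 0, p 1, q 1, p 2, q 2, p 3, q 3].getD n 0
    refine ⟨D, ?_, ?_⟩
    · simp [D, Fin.sum_univ_four, Finset.sum_range_succ] at h1 ⊢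
      linarith
    · simp [D, Fin.sum_univ_four, Finset.sum_range_succ] at h2 ⊢
      linarith

theorem exists_arc_from {r : ZMod 20 → ℝ} (hr : ∀ i, 0 < r i)
    (hpair : ∀ j : ZMod 20, j.val % 2 = 1 → min (r j) (r (j + 1)) ≤ 2) (k : ZMod 20) :
    ∃ B : ℕ → ℝ, B 0 = 0 ∧ B 9 = 1 ∧
      ∑ n ∈ Finset.range 9, r (k + n) * (B (n + 1) - B n) ^ 2 < 1 / 2 := by
  refine exists_arc (x := fun n => r (k + n)) (fun n => hr _) ?_
  have hodd : ∀ k : ZMod 20, k.val % 2 = 1 → ∀ m < 4, (k + (2 * m : ℕ)).val % 2 = 1 := by decide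
  have heven : ∀ k : ZMod 20, k.val % 2 = 0 → ∀ m < 4, (k + (2 * m + 1 : ℕ)).val % 2 = 1 := by
    decide
  rcases Nat.mod_two_eq_zero_or_one k.val with hk | hk
  · right
    intro m hm
    convert hpair _ (heven k hk m hm) using 3
    push_cast; ring
  · left
    intro m hm
    convert hpair _ (hodd k hk m hm) using 3
    push_cast; ring

theorem exists_ring_potential {r : ZMod 20 → ℝ} (hr : ∀ i, 0 < r i)
    (hpair : ∀ j : ZMod 20, j.val % 2 = 1 → min (r j) (r (j + 1)) ≤ 2) (i : ZMod 20) :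
    ∃ a : ZMod 20 → ℝ, a i = 0 ∧ a (i + 1) = 0 ∧ a (i + 10) = 1 ∧ a (i + 11) = 1 ∧
      ∑ j, r j * (a (j + 1) - a j) ^ 2 < 1 := by
  obtain ⟨B, hB0, hB9, hB⟩ := exists_arc_from hr hpair (i + 1)
  obtain ⟨B', hB0', hB9', hB'⟩ := exists_arc_from hr hpair (i + 11)
  let A : ℕ → ℝ := fun n => if n ≤ 10 then B (n - 1) else 1 - B' (n - 11)
  have hA20 : A 20 = A 0 := by simp [A, hB0, hB9']
  have hA : ∀ n : ZMod 20, A (n + 1).val = A (n.val + 1) := by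
    have hval : ∀ n : ZMod 20, (n + 1).val = n.val + 1 ∨ (n + 1).val = 0 ∧ n.val + 1 = 20 := by
      decide
    intro n
    rcases hval n with h | ⟨h, h'⟩
    · rw [h]
    · rw [h, h', hA20]
  refine ⟨fun j => A (j - i).val, ?_, ?_, ?_, ?_, ?_⟩
  · simpa [A] using hB0
  · beta_reduce; rw [add_sub_cancel_left]; exact hB0
  · beta_reduce; rw [add_sub_cancel_left]; exact hB9
  · beta_reduce; rw [add_sub_cancel_left]; change 1 - B' 0 = 1; rw [hB0', sub_zero]
  · have hsum : ∑ j, r j * (A (j + 1 - i).val - A (j - i).val) ^ 2 =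
        ∑ n ∈ Finset.range 20, r (i + n) * (A (n + 1) - A n) ^ 2 := by
      rw [← Equiv.sum_comp (Equiv.addLeft i)]
      refine Eq.trans (Finset.sum_congr rfl fun n _ => ?_)
        (Fin.sum_univ_eq_sum_range (fun n => r (i + n) * (A (n + 1) - A n) ^ 2) 20)
      have h1 : i + n + 1 - i = n + 1 := by ring
      rw [Equiv.coe_addLeft, add_sub_cancel_left, h1, hA]
      change _ = r (i + (n.val : ZMod 20)) * (A (n.val + 1) - A n.val) ^ 2
      rw [ZMod.natCast_zmod_val]
    rw [hsum]
    simp only [Finset.sum_range_succ, Finset.sum_range_zero] at hB hB' ⊢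
    norm_num [A, hB0, hB9, hB0', hB9', add_assoc] at hB hB' ⊢
    linarith

/-- Second step in the proof of Theorem 3.2: if `Λ_r(E) = E`, then
`r̄ := max { min (r (2h+1)) (r (2h+2)) : h = 0, …, 9 } > 2`. -/
theorem two_lt_rbar (F : ExampleFractal V1)
    (E : (ZMod 20 → ℝ) → ℝ) (hE : IsIrreducibleDirichletForm E)
    (r : ZMod 20 → ℝ) (hr : ∀ i, 0 < r i)
    (heig : Lam F r E = E) :
    2 < (Finset.range 10).sup' (by norm_num)
      (fun h => min (r ((2 * h + 1 : ℕ) : ZMod 20)) (r ((2 * h + 2 : ℕ) : ZMod 20))) := by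
  by_contra hcon
  rw [not_lt, Finset.sup'_le_iff] at hcon
  have hpair : ∀ j : ZMod 20, j.val % 2 = 1 → min (r j) (r (j + 1)) ≤ 2 := by
    intro j hj
    have h := hcon (j.val / 2) (Finset.mem_range.2 (by have := ZMod.val_lt j; omega))
    have e1 : ((2 * (j.val / 2) + 1 : ℕ) : ZMod 20) = j := by clear * - hj; revert j; decide
    have e2 : ((2 * (j.val / 2) + 2 : ℕ) : ZMod 20) = j + 1 := by clear * - hj; revert j; decide
    rwa [e1, e2] at h
  have hne : ∀ j : ZMod 20, j ≠ j + 10 := by decide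
  choose f hf0 hf1 hfmin using fun j => hE.1.exists_min (hne j)
  obtain ⟨i, -, hi⟩ := Finset.exists_max_image Finset.univ (fun j => E (f j)) Finset.univ_nonempty
  have hpos : 0 < E (f i) := by
    refine (hE.1.nonneg _).lt_of_ne' fun h0 => ?_
    have := (hE.2 _).1 h0 i (i + 10)
    rw [hf0, hf1] at this
    exact zero_ne_one this
  obtain ⟨a, ha0, ha1, ha10, ha11, ha⟩ := exists_ring_potential hr hpair i
  obtain ⟨v, hv⟩ := F.exists_glue a
    (fun j k => a j + (a (j + 1) - a j) * f (leftIndex j) k)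
    (by simp [hf0]) (by simp [hf1])
  have hS : S1r F r E v ≤ (∑ j, r j * (a (j + 1) - a j) ^ 2) * E (f i) := by
    simp only [S1r, hv, hE.1.affine, Finset.sum_mul]
    refine Finset.sum_le_sum fun j _ => ?_
    rw [← mul_assoc]
    exact mul_le_mul_of_nonneg_left (hi _ (Finset.mem_univ _))
      (mul_nonneg (hr j).le (sq_nonneg _))
  have hL := Lam_le_S1r F hE.1 hr v
  rw [heig] at hL
  have hmin : E (f i) ≤ E (fun j => v (F.P j)) := by
    refine hfmin i _ ?_ ?_
    · simp only [← F.fixed, hv, ha0, ha1]; ring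
    · have h11 : i + 10 + 1 = i + 11 := by ring
      simp only [← F.fixed, hv, h11, ha10, ha11]; ring
  nlinarith
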